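/- Assume in addition that g is continuous. For every γ ∈ (0, √d), every bounded measurable f : ℝ^d → [0,∞) and every compact set A ⊂ ℝ^d, the family (M_ε(A))_{ε∈(0,1]} is Cauchy in L²(P) as ε → 0: E[ (M_ε(A) − M_{ε'}(A))² ] → 0 as ε, ε' → 0. Consequently M_ε(A) converges in L²(P) to a random variable Z(A) with E[Z(A)] = ∫_A f(x) dx (equal to the Lebesgue volume of A when f ≡ 1). -/

import Mathlib

open MeasureTheory ProbabilityTheory Filter Topology
open scoped ENNReal NNReal

noncomputable section

variable {d : ℕ}

/-- The rescaled mollifier `θ_ε(x) = ε^{-d} θ(x/ε)`. -/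
def mollifierScaled (θ : EuclideanSpace ℝ (Fin d) → ℝ) (ε : ℝ)
    (x : EuclideanSpace ℝ (Fin d)) : ℝ :=
  (ε ^ d)⁻¹ * θ (ε⁻¹ • x)

/-- A nonnegative smooth mollifier: `C^∞`, compactly supported, nonnegative, total integral 1. -/
def IsMollifier (θ : EuclideanSpace ℝ (Fin d) → ℝ) : Prop :=
  ContDiff ℝ (⊤ : ℕ∞) θ ∧ HasCompactSupport θ ∧ (∀ x, 0 ≤ θ x) ∧ (∫ x, θ x) = 1

/-- The kernel of log-type associated to `g`: `K(x,y) = ln₊(1/|x-y|) + g(x,y)` where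
`ln₊ u = max (ln u) 0`. -/
def logKernel (g : EuclideanSpace ℝ (Fin d) → EuclideanSpace ℝ (Fin d) → ℝ)
    (x y : EuclideanSpace ℝ (Fin d)) : ℝ :=
  max (Real.log (dist x y)⁻¹) 0 + g x y

/-- `g` is bounded and (jointly) measurable. -/
def IsBoundedMeasurable (g : EuclideanSpace ℝ (Fin d) → EuclideanSpace ℝ (Fin d) → ℝ) : Prop :=
  Measurable (Function.uncurry g) ∧ ∃ C, ∀ x y, |g x y| ≤ C

/-- The mollified covariance `K_{ε,ε'}(x,y) = ∫∫ θ₁_ε(u) θ₂_{ε'}(v) K(x-u, y-v) du dv`. -/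
def mollifiedCov (K : EuclideanSpace ℝ (Fin d) → EuclideanSpace ℝ (Fin d) → ℝ)
    (θ₁ θ₂ : EuclideanSpace ℝ (Fin d) → ℝ) (ε ε' : ℝ)
    (x y : EuclideanSpace ℝ (Fin d)) : ℝ :=
  ∫ u, ∫ v, mollifierScaled θ₁ ε u * mollifierScaled θ₂ ε' v * K (x - u) (y - v)

/-- `X = (X(ε,x))` is a jointly measurable family whose finite-dimensional distributions are
centered Gaussian with covariance `E[X(ε,x) X(ε',y)] = Km ε ε' x y` (expressed by requiring
every finite real linear combination to have the appropriate centered Gaussian law). -/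
def IsGaussianFamily {Ω : Type*} [MeasurableSpace Ω] (P : Measure Ω)
    (X : ℝ → EuclideanSpace ℝ (Fin d) → Ω → ℝ)
    (Km : ℝ → ℝ → EuclideanSpace ℝ (Fin d) → EuclideanSpace ℝ (Fin d) → ℝ) : Prop :=
  (Measurable fun p : ℝ × EuclideanSpace ℝ (Fin d) × Ω => X p.1 p.2.1 p.2.2) ∧
  ∀ (n : ℕ) (ε : Fin n → ℝ) (x : Fin n → EuclideanSpace ℝ (Fin d)),
    (∀ i, ε i ∈ Set.Ioc (0 : ℝ) 1) → ∀ l : Fin n → ℝ, ∃ v : ℝ≥0,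
      (v : ℝ) = ∑ i, ∑ j, l i * l j * Km (ε i) (ε j) (x i) (x j) ∧
      Measure.map (fun ω => ∑ i, l i * X (ε i) (x i) ω) P = gaussianReal 0 v

/-- The approximate Gaussian multiplicative chaos measure
`M_ε(A) = ∫_A exp(γ X(ε,x) - (γ²/2) Km ε ε x x) f(x) dx`. -/
def approxGMC {Ω : Type*} (γ : ℝ) (X : ℝ → EuclideanSpace ℝ (Fin d) → Ω → ℝ)
    (Km : ℝ → ℝ → EuclideanSpace ℝ (Fin d) → EuclideanSpace ℝ (Fin d) → ℝ)
    (f : EuclideanSpace ℝ (Fin d) → ℝ) (ε : ℝ) (ω : Ω)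
    (A : Set (EuclideanSpace ℝ (Fin d))) : ℝ :=
  ∫ x in A, Real.exp (γ * X ε x ω - γ ^ 2 / 2 * Km ε ε x x) * f x

/-- `M` is the Gaussian multiplicative chaos measure on `D`: a random Radon measure on `D`
such that `M_ε(A) → M(A)` in probability as `ε → 0` for every Borel `A` with compact closure
contained in `D`. -/
def IsGMCMeasure {Ω : Type*} [MeasurableSpace Ω] (P : Measure Ω) (γ : ℝ)
    (X : ℝ → EuclideanSpace ℝ (Fin d) → Ω → ℝ)
    (Km : ℝ → ℝ → EuclideanSpace ℝ (Fin d) → EuclideanSpace ℝ (Fin d) → ℝ)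
    (f : EuclideanSpace ℝ (Fin d) → ℝ) (D : Set (EuclideanSpace ℝ (Fin d)))
    (M : Ω → Measure (EuclideanSpace ℝ (Fin d))) : Prop :=
  (∀ A : Set (EuclideanSpace ℝ (Fin d)), MeasurableSet A → Measurable fun ω => M ω A) ∧
  (∀ ω, ∀ A : Set (EuclideanSpace ℝ (Fin d)), IsCompact (closure A) → closure A ⊆ D →
    M ω A ≠ ⊤) ∧
  (∀ A : Set (EuclideanSpace ℝ (Fin d)), MeasurableSet A → IsCompact (closure A) →
    closure A ⊆ D →
    TendstoInMeasure P (fun ε ω => approxGMC γ X Km f ε ω A) (𝓝[Set.Ioc (0 : ℝ) 1] 0)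
      fun ω => (M ω A).toReal)


section LogSingularity

open Real Module

variable {E : Type*} [NormedAddCommGroup E]

/-- The logarithmic singularity `ln₊ (1 / |z|)`. -/
def logSing (z : E) : ℝ := log⁺ ‖z‖⁻¹

lemma logSing_nonneg (z : E) : 0 ≤ logSing z := posLog_nonneg

lemma logSing_neg (z : E) : logSing (-z) = logSing z := by simp [logSing]

lemma logSing_of_one_le {z : E} (hz : 1 ≤ ‖z‖) : logSing z = 0 := by
  rw [logSing, posLog_eq_zero_iff, abs_of_nonneg (by positivity)]
  exact inv_le_one_of_one_le₀ hz

lemma logSing_sub_comm (x y : E) : logSing (x - y) = logSing (y - x) := by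
  rw [← logSing_neg, neg_sub]

lemma logSing_le_of_norm_le {z w : E} (hz : z ≠ 0) {c : ℝ} (h : ‖z‖ ≤ c * ‖w‖) :
    logSing w ≤ log⁺ c + logSing z := by
  have hz' : 0 < ‖z‖ := norm_pos_iff.2 hz
  have hw : 0 < ‖w‖ := by
    by_contra hw
    have : ‖w‖ = 0 := le_antisymm (not_lt.1 hw) (norm_nonneg _)
    rw [this] at h
    linarith
  refine le_trans (posLog_le_posLog (y := c * ‖z‖⁻¹) (by positivity) ?_) posLog_mul
  rw [← div_eq_mul_inv, le_div_iff₀ hz', ← div_eq_inv_mul, div_le_iff₀ hw]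
  exact h

lemma continuousAt_logSing {z : E} (hz : z ≠ 0) : ContinuousAt logSing z :=
  continuous_posLog.continuousAt.comp (continuousAt_id.norm.inv₀ (norm_ne_zero_iff.2 hz))

lemma measurable_logSing [MeasurableSpace E] [OpensMeasurableSpace E] :
    Measurable (logSing : E → ℝ) :=
  continuous_posLog.measurable.comp measurable_norm.inv

variable [NormedSpace ℝ E]

lemma logSing_smul_le (c : ℝ) (z : E) : logSing (c • z) ≤ log⁺ c⁻¹ + logSing z := by
  rw [logSing, norm_smul, mul_inv]
  refine posLog_mul.trans (add_le_add ?_ le_rfl)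
  rw [norm_eq_abs, ← abs_inv, posLog_abs]

variable [MeasurableSpace E] [BorelSpace E] [FiniteDimensional ℝ E] {ν : Measure E}
  [ν.IsAddHaarMeasure]

lemma integrable_exp_mul_logSing_sub_one (hE : 1 ≤ finrank ℝ E) {s : ℝ} (hs : 0 ≤ s)
    (hsE : s < finrank ℝ E) : Integrable (fun z : E => exp (s * logSing z) - 1) ν := by
  have hmeas : Measurable (fun z : E => exp (s * logSing z) - 1) :=
    ((measurable_logSing.const_mul s).exp).sub_const 1
  have h : IntegrableOn (fun z : E => exp (s * logSing z) - 1) (Metric.ball 0 1) ν := by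
    refine integrableOn_ball_of_norm_le_rpow (C := 1) hE hsE ?_ hmeas.aestronglyMeasurable
    have : Nontrivial E := nontrivial_of_finrank_pos (R := ℝ) hE
    have h0 : ∀ᵐ z : E ∂ν, z ≠ 0 := by simp [ae_iff]
    filter_upwards [ae_restrict_mem measurableSet_ball, ae_restrict_of_ae h0] with z hz hz0
    have hz0' : 0 < ‖z‖ := norm_pos_iff.2 hz0
    have hz1 : ‖z‖ < 1 := by simpa using hz
    have hlog : logSing z = log ‖z‖⁻¹ := by
      rw [logSing, posLog_eq_log]
      rw [abs_of_nonneg (by positivity)]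
      exact (one_le_inv₀ hz0').2 hz1.le
    have h1 : 1 ≤ exp (s * logSing z) :=
      one_le_exp (mul_nonneg hs (logSing_nonneg z))
    rw [norm_of_nonneg (by linarith), one_mul, rpow_def_of_pos hz0', hlog, log_inv]
    have : s * -log ‖z‖ = log ‖z‖ * -s := by ring
    rw [this]
    linarith
  refine (integrableOn_iff_integrable_of_support_subset fun z hz => ?_).1 h
  by_contra hz'
  refine hz ?_
  have : 1 ≤ ‖z‖ := by simpa using hz'
  simp [logSing_of_one_le this]

lemma integrable_logSing (hE : 1 ≤ finrank ℝ E) : Integrable (logSing : E → ℝ) ν := by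
  have hE' : (1 : ℝ) ≤ finrank ℝ E := by exact_mod_cast hE
  have h := (integrable_exp_mul_logSing_sub_one (ν := ν) hE (s := 1 / 2) (by norm_num)
    (by linarith)).const_mul 2
  refine h.mono' measurable_logSing.aestronglyMeasurable (Eventually.of_forall fun z => ?_)
  rw [norm_of_nonneg (logSing_nonneg z)]
  linarith [add_one_le_exp (1 / 2 * logSing z)]

end LogSingularity

section LogPotential

open Real

variable {E : Type*} [NormedAddCommGroup E] [MeasurableSpace E]

/-- The logarithmic potential of `μ` is finite and bounded above by `B`. -/
def LogPotentialBound (μ : Measure E) (B : ℝ) : Prop :=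
  ∀ a, Integrable (fun u => logSing (a + u)) μ ∧ ∫ u, logSing (a + u) ∂μ ≤ B

variable {μ : Measure E} {B : ℝ}

lemma LogPotentialBound.nonneg (hμ : LogPotentialBound μ B) : 0 ≤ B :=
  (integral_nonneg fun _ => logSing_nonneg _).trans (hμ 0).2

variable [NormedSpace ℝ E] [BorelSpace E] [IsProbabilityMeasure μ]

lemma LogPotentialBound.smul (hμ : LogPotentialBound μ B) (a : E) {c : ℝ} (hc : c ≠ 0) :
    Integrable (fun u => logSing (a + c • u)) μ ∧
      ∫ u, logSing (a + c • u) ∂μ ≤ log⁺ c⁻¹ + B := by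
  have hle : ∀ u, logSing (a + c • u) ≤ log⁺ c⁻¹ + logSing (c⁻¹ • a + u) := fun u => by
    have : a + c • u = c • (c⁻¹ • a + u) := by rw [smul_add, smul_inv_smul₀ hc]
    rw [this]
    exact logSing_smul_le _ _
  have hint : Integrable (fun u => log⁺ c⁻¹ + logSing (c⁻¹ • a + u)) μ :=
    (integrable_const _).add (hμ _).1
  have hint' : Integrable (fun u => logSing (a + c • u)) μ := by
    refine hint.mono' (measurable_logSing.comp (by fun_prop)).aestronglyMeasurable
      (Eventually.of_forall fun u => ?_)
    rw [norm_of_nonneg (logSing_nonneg _)]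
    exact hle u
  refine ⟨hint', (integral_mono hint' hint hle).trans ?_⟩
  rw [integral_add (integrable_const _) (hμ _).1]
  simpa using (hμ _).2

variable [SecondCountableTopology E]

lemma LogPotentialBound.prod (hμ : LogPotentialBound μ B) (z : E) (a : ℝ) {b : ℝ} (hb : b ≠ 0) :
    Integrable (fun p : E × E => logSing (z + a • p.1 + b • p.2)) (μ.prod μ) ∧
      ∫ p : E × E, logSing (z + a • p.1 + b • p.2) ∂(μ.prod μ) ≤ log⁺ b⁻¹ + B := by
  have hmeas : Measurable (fun p : E × E => logSing (z + a • p.1 + b • p.2)) :=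
    measurable_logSing.comp (by fun_prop)
  have hin : Integrable (fun u => ∫ v, logSing (z + a • u + b • v) ∂μ) μ := by
    refine (integrable_const (log⁺ b⁻¹ + B)).mono'
      hmeas.stronglyMeasurable.integral_prod_right'.aestronglyMeasurable
      (Eventually.of_forall fun u => ?_)
    rw [norm_of_nonneg (integral_nonneg fun _ => logSing_nonneg _)]
    exact (hμ.smul (z + a • u) hb).2
  have hint : Integrable (fun p : E × E => logSing (z + a • p.1 + b • p.2)) (μ.prod μ) := by
    rw [integrable_prod_iff hmeas.aestronglyMeasurable]
    refine ⟨Eventually.of_forall fun u => (hμ.smul (z + a • u) hb).1, ?_⟩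
    simpa only [norm_of_nonneg (logSing_nonneg _)] using hin
  refine ⟨hint, ?_⟩
  rw [integral_prod _ hint]
  refine (integral_mono hin (integrable_const (log⁺ b⁻¹ + B)) fun u =>
    (hμ.smul (z + a • u) hb).2).trans ?_
  simp

lemma LogPotentialBound.prod_le_of_abs_le (hμ : LogPotentialBound μ B) {R : ℝ}
    (hR : ∀ᵐ u ∂μ, ‖u‖ ≤ R) {z : E} (hz : z ≠ 0) {a b : ℝ} (hb : b ≠ 0) (hab : |a| ≤ |b|) :
    ∫ p : E × E, logSing (z + a • p.1 + b • p.2) ∂(μ.prod μ) ≤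
      logSing z + (log⁺ (4 * R) + log⁺ 2 + B) := by
  obtain ⟨hint, hle⟩ := hμ.prod z a hb
  have hB := hμ.nonneg
  have hR0 : 0 ≤ R := by
    obtain ⟨u, hu⟩ := hR.exists
    exact (norm_nonneg u).trans hu
  have hz' : 0 < ‖z‖ := norm_pos_iff.2 hz
  have hb' : 0 < |b| := abs_pos.2 hb
  have h4R : 0 ≤ log⁺ (4 * R) := posLog_nonneg
  have h2 : 0 ≤ log⁺ (2 : ℝ) := posLog_nonneg
  rcases le_total ‖z‖ (4 * R * |b|) with hzR | hzR
  · have : log⁺ b⁻¹ ≤ log⁺ (4 * R) + logSing z := by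
      refine le_trans ?_ posLog_mul
      rw [← posLog_abs, abs_inv]
      refine posLog_le_posLog (by positivity) ?_
      rw [← div_eq_mul_inv, le_div_iff₀ hz', ← div_eq_inv_mul, div_le_iff₀ hb']
      exact hzR
    linarith
  · have hfar : ∀ᵐ p ∂(μ.prod μ), logSing (z + a • p.1 + b • p.2) ≤ log⁺ 2 + logSing z := by
      have h1 : ∀ᵐ p : E × E ∂(μ.prod μ), ‖p.1‖ ≤ R :=
        Measure.quasiMeasurePreserving_fst.ae hR
      have h2 : ∀ᵐ p : E × E ∂(μ.prod μ), ‖p.2‖ ≤ R :=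
        Measure.quasiMeasurePreserving_snd.ae hR
      filter_upwards [h1, h2] with p hp1 hp2
      refine logSing_le_of_norm_le hz ?_
      have e1 : ‖a • p.1‖ ≤ |b| * R := by
        rw [norm_smul, norm_eq_abs]
        exact mul_le_mul hab hp1 (norm_nonneg _) hb'.le
      have e2 : ‖b • p.2‖ ≤ |b| * R := by
        rw [norm_smul, norm_eq_abs]
        exact mul_le_mul_of_nonneg_left hp2 hb'.le
      have e3 : ‖z‖ ≤ ‖z + a • p.1 + b • p.2‖ + ‖a • p.1‖ + ‖b • p.2‖ := by
        have : z = z + a • p.1 + b • p.2 - a • p.1 - b • p.2 := by abel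
        calc ‖z‖ = ‖z + a • p.1 + b • p.2 - a • p.1 - b • p.2‖ := by rw [← this]
          _ ≤ _ := (norm_sub_le _ _).trans (add_le_add (norm_sub_le _ _) le_rfl)
      linarith
    refine (integral_mono_ae hint (integrable_const _) hfar).trans ?_
    simp only [integral_const, probReal_univ, one_smul]
    linarith

lemma LogPotentialBound.prod_le (hμ : LogPotentialBound μ B) {R : ℝ}
    (hR : ∀ᵐ u ∂μ, ‖u‖ ≤ R) {z : E} (hz : z ≠ 0) {a b : ℝ} (ha : a ≠ 0) (hb : b ≠ 0) :
    ∫ p : E × E, logSing (z + a • p.1 + b • p.2) ∂(μ.prod μ) ≤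
      logSing z + (log⁺ (4 * R) + log⁺ 2 + B) := by
  rcases le_total |a| |b| with hab | hab
  · exact hμ.prod_le_of_abs_le hR hz hb hab
  · rw [← integral_prod_swap]
    simp only [Prod.fst_swap, Prod.snd_swap]
    simpa only [add_right_comm] using hμ.prod_le_of_abs_le hR hz ha hab

end LogPotential

section MollifiedCovariance

open Real Module

/-- The probability measure with density a mollifier `θ`. -/
def mollifierMeasure (θ : EuclideanSpace ℝ (Fin d) → ℝ) : Measure (EuclideanSpace ℝ (Fin d)) :=
  volume.withDensity fun u => ENNReal.ofReal (θ u)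

variable {θ : EuclideanSpace ℝ (Fin d) → ℝ}

lemma IsMollifier.continuous (hθ : IsMollifier θ) : Continuous θ := hθ.1.continuous

lemma IsMollifier.integral_mollifierMeasure (hθ : IsMollifier θ)
    (F : EuclideanSpace ℝ (Fin d) → ℝ) :
    ∫ u, F u ∂(mollifierMeasure θ) = ∫ u, θ u * F u := by
  rw [mollifierMeasure, integral_withDensity_eq_integral_toReal_smul
    hθ.continuous.measurable.ennreal_ofReal (by simp)]
  simp [ENNReal.toReal_ofReal (hθ.2.2.1 _)]

lemma IsMollifier.isProbabilityMeasure (hθ : IsMollifier θ) :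
    IsProbabilityMeasure (mollifierMeasure θ) := by
  constructor
  rw [mollifierMeasure, withDensity_apply _ MeasurableSet.univ, setLIntegral_univ,
    ← ofReal_integral_eq_lintegral_ofReal (hθ.continuous.integrable_of_hasCompactSupport hθ.2.1)
      (Eventually.of_forall hθ.2.2.1), hθ.2.2.2, ENNReal.ofReal_one]

lemma IsMollifier.exists_ae_norm_le (hθ : IsMollifier θ) :
    ∃ R, ∀ᵐ u ∂(mollifierMeasure θ), ‖u‖ ≤ R := by
  obtain ⟨R, hR⟩ := hθ.2.1.isCompact.isBounded.exists_norm_le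
  refine ⟨R, ?_⟩
  rw [mollifierMeasure, ae_withDensity_iff hθ.continuous.measurable.ennreal_ofReal]
  refine Eventually.of_forall fun u hu => hR u (subset_tsupport _ ?_)
  intro h
  simp [h] at hu

lemma IsMollifier.exists_logPotentialBound (hθ : IsMollifier θ) (hd : 1 ≤ d) :
    ∃ B, LogPotentialBound (mollifierMeasure θ) B := by
  obtain ⟨C, hC⟩ := hθ.2.1.exists_bound_of_continuous hθ.continuous
  have hlog : Integrable (logSing : EuclideanSpace ℝ (Fin d) → ℝ) volume :=
    integrable_logSing (by simpa using hd)
  refine ⟨C * ∫ u : EuclideanSpace ℝ (Fin d), logSing u, fun a => ?_⟩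
  have hloga : Integrable (fun u => logSing (a + u)) volume := hlog.comp_add_left a
  have hint : Integrable (fun u => θ u * logSing (a + u)) volume :=
    hloga.bdd_mul hθ.continuous.aestronglyMeasurable (Eventually.of_forall hC)
  constructor
  · rw [mollifierMeasure, integrable_withDensity_iff_integrable_smul'
      hθ.continuous.measurable.ennreal_ofReal (by simp)]
    simpa [ENNReal.toReal_ofReal (hθ.2.2.1 _)] using hint
  · rw [hθ.integral_mollifierMeasure, ← integral_add_left_eq_self logSing a,
      ← integral_const_mul]
    exact integral_mono hint (hloga.const_mul C) fun u =>
      mul_le_mul_of_nonneg_right ((le_abs_self _).trans (hC u)) (logSing_nonneg _)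

lemma IsMollifier.integral_mollifierScaled_mul (hθ : IsMollifier θ) {ε : ℝ} (hε : 0 < ε)
    (F : EuclideanSpace ℝ (Fin d) → ℝ) :
    ∫ u, mollifierScaled θ ε u * F u = ∫ u, F (ε • u) ∂(mollifierMeasure θ) := by
  have h := Measure.integral_comp_smul (volume : Measure (EuclideanSpace ℝ (Fin d)))
    (fun w => θ (ε⁻¹ • w) * F w) ε
  simp only [inv_smul_smul₀ hε.ne', finrank_euclideanSpace_fin] at h
  rw [hθ.integral_mollifierMeasure, h, abs_of_pos (by positivity), smul_eq_mul,
    ← integral_const_mul]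
  simp only [mollifierScaled, mul_assoc]

lemma IsMollifier.mollifiedCov_eq (hθ : IsMollifier θ)
    (K : EuclideanSpace ℝ (Fin d) → EuclideanSpace ℝ (Fin d) → ℝ) {ε ε' : ℝ} (hε : 0 < ε)
    (hε' : 0 < ε') (x y : EuclideanSpace ℝ (Fin d)) :
    mollifiedCov K θ θ ε ε' x y =
      ∫ u, ∫ v, K (x - ε • u) (y - ε' • v) ∂(mollifierMeasure θ) ∂(mollifierMeasure θ) := by
  simp only [mollifiedCov, mul_assoc, integral_const_mul]
  rw [hθ.integral_mollifierScaled_mul hε]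
  simp only [hθ.integral_mollifierScaled_mul hε']

variable {g : EuclideanSpace ℝ (Fin d) → EuclideanSpace ℝ (Fin d) → ℝ}

lemma logKernel_eq (x y : EuclideanSpace ℝ (Fin d)) :
    logKernel g x y = logSing (x - y) + g x y := by
  rw [logKernel, logSing, posLog_apply, max_comm, dist_eq_norm]

lemma measurable_mollifiedCov (hg : Measurable (Function.uncurry g)) (hθ : IsMollifier θ)
    {ε ε' : ℝ} (hε : 0 < ε) (hε' : 0 < ε') :
    Measurable (fun p : EuclideanSpace ℝ (Fin d) × EuclideanSpace ℝ (Fin d) =>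
      mollifiedCov (logKernel g) θ θ ε ε' p.1 p.2) := by
  have := hθ.isProbabilityMeasure
  simp only [hθ.mollifiedCov_eq _ hε hε', logKernel_eq]
  refine StronglyMeasurable.measurable ?_
  refine StronglyMeasurable.integral_prod_right
    (f := fun p : EuclideanSpace ℝ (Fin d) × EuclideanSpace ℝ (Fin d) => fun u => ∫ v,
      (logSing (p.1 - ε • u - (p.2 - ε' • v)) + g (p.1 - ε • u) (p.2 - ε' • v))
        ∂(mollifierMeasure θ)) ?_
  refine StronglyMeasurable.integral_prod_right
    (f := fun q : (EuclideanSpace ℝ (Fin d) × EuclideanSpace ℝ (Fin d)) ×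
        EuclideanSpace ℝ (Fin d) => fun v =>
      (logSing (q.1.1 - ε • q.2 - (q.1.2 - ε' • v)) + g (q.1.1 - ε • q.2) (q.1.2 - ε' • v))) ?_
  refine Measurable.stronglyMeasurable (Measurable.add ?_ ?_)
  · exact measurable_logSing.comp (by fun_prop)
  · exact hg.comp (f := fun r : ((EuclideanSpace ℝ (Fin d) × EuclideanSpace ℝ (Fin d)) ×
      EuclideanSpace ℝ (Fin d)) × EuclideanSpace ℝ (Fin d) =>
      (r.1.1.1 - ε • r.1.2, r.1.1.2 - ε' • r.2)) (by fun_prop)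

lemma integrable_logSing_mollified (hθ : IsMollifier θ) (hd : 1 ≤ d) (ε : ℝ) {ε' : ℝ}
    (hε' : 0 < ε') (x y : EuclideanSpace ℝ (Fin d)) :
    Integrable (fun p : EuclideanSpace ℝ (Fin d) × EuclideanSpace ℝ (Fin d) =>
      logSing (x - ε • p.1 - (y - ε' • p.2)))
      ((mollifierMeasure θ).prod (mollifierMeasure θ)) := by
  have := hθ.isProbabilityMeasure
  obtain ⟨B, hB⟩ := hθ.exists_logPotentialBound hd
  convert (hB.prod (x - y) (-ε) hε'.ne').1 using 3
  module

lemma integrable_bounded_mollified (hg : IsBoundedMeasurable g) (hθ : IsMollifier θ) (ε ε' : ℝ)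
    (x y : EuclideanSpace ℝ (Fin d)) :
    Integrable (fun p : EuclideanSpace ℝ (Fin d) × EuclideanSpace ℝ (Fin d) =>
      g (x - ε • p.1) (y - ε' • p.2))
      ((mollifierMeasure θ).prod (mollifierMeasure θ)) := by
  have := hθ.isProbabilityMeasure
  obtain ⟨hgm, C, hC⟩ := hg
  refine (integrable_const C).mono' ?_ (Eventually.of_forall fun p => hC _ _)
  exact (hgm.comp (f := fun p : EuclideanSpace ℝ (Fin d) × EuclideanSpace ℝ (Fin d) =>
    (x - ε • p.1, y - ε' • p.2)) (by fun_prop)).aestronglyMeasurable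

lemma integrable_logKernel_mollified (hg : IsBoundedMeasurable g) (hθ : IsMollifier θ)
    (hd : 1 ≤ d) (ε : ℝ) {ε' : ℝ} (hε' : 0 < ε') (x y : EuclideanSpace ℝ (Fin d)) :
    Integrable (fun p : EuclideanSpace ℝ (Fin d) × EuclideanSpace ℝ (Fin d) =>
      logKernel g (x - ε • p.1) (y - ε' • p.2))
      ((mollifierMeasure θ).prod (mollifierMeasure θ)) := by
  simp only [logKernel_eq]
  exact (integrable_logSing_mollified hθ hd ε hε' x y).add
    (integrable_bounded_mollified hg hθ ε ε' x y)

lemma mollifiedCov_logKernel_eq (hg : IsBoundedMeasurable g) (hθ : IsMollifier θ)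
    (hd : 1 ≤ d) {ε ε' : ℝ} (hε : 0 < ε) (hε' : 0 < ε') (x y : EuclideanSpace ℝ (Fin d)) :
    mollifiedCov (logKernel g) θ θ ε ε' x y =
      ∫ p : EuclideanSpace ℝ (Fin d) × EuclideanSpace ℝ (Fin d),
        logKernel g (x - ε • p.1) (y - ε' • p.2)
          ∂((mollifierMeasure θ).prod (mollifierMeasure θ)) := by
  have := hθ.isProbabilityMeasure
  rw [hθ.mollifiedCov_eq _ hε hε',
    integral_prod _ (integrable_logKernel_mollified hg hθ hd ε hε' x y)]

/-- The mollified covariance is bounded above by the logarithm, uniformly in the mollification. -/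
lemma exists_mollifiedCov_le (hg : IsBoundedMeasurable g) (hθ : IsMollifier θ) (hd : 1 ≤ d) :
    ∃ C, ∀ ε ε' : ℝ, 0 < ε → 0 < ε' → ∀ x y : EuclideanSpace ℝ (Fin d), x ≠ y →
      mollifiedCov (logKernel g) θ θ ε ε' x y ≤ logSing (x - y) + C := by
  have := hθ.isProbabilityMeasure
  obtain ⟨B, hB⟩ := hθ.exists_logPotentialBound hd
  obtain ⟨R, hR⟩ := hθ.exists_ae_norm_le
  obtain ⟨-, C, hC⟩ := id hg
  refine ⟨log⁺ (4 * R) + log⁺ 2 + B + C, fun ε ε' hε hε' x y hxy => ?_⟩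
  rw [mollifiedCov_logKernel_eq hg hθ hd hε hε']
  simp only [logKernel_eq]
  rw [integral_add (integrable_logSing_mollified hθ hd ε hε' x y)
    (integrable_bounded_mollified hg hθ ε ε' x y), ← add_assoc]
  refine add_le_add ?_ ?_
  · have hsplit : ∀ p : EuclideanSpace ℝ (Fin d) × EuclideanSpace ℝ (Fin d),
        x - ε • p.1 - (y - ε' • p.2) = x - y + (-ε) • p.1 + ε' • p.2 := fun p => by module
    simp only [hsplit]
    exact hB.prod_le hR (sub_ne_zero.2 hxy) (neg_ne_zero.2 hε.ne') hε'.ne'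
  · refine (integral_mono (integrable_bounded_mollified hg hθ ε ε' x y) (integrable_const C)
      fun p => (le_abs_self _).trans (hC _ _)).trans ?_
    simp

lemma tendsto_mollifiedCov (hg : IsBoundedMeasurable g)
    (hgcont : Continuous (Function.uncurry g)) (hθ : IsMollifier θ) (hd : 1 ≤ d)
    {x y : EuclideanSpace ℝ (Fin d)} (hxy : x ≠ y) :
    Tendsto (fun p : ℝ × ℝ => mollifiedCov (logKernel g) θ θ p.1 p.2 x y)
      ((𝓝[Set.Ioc (0 : ℝ) 1] 0) ×ˢ (𝓝[Set.Ioc (0 : ℝ) 1] 0)) (𝓝 (logKernel g x y)) := by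
  have := hθ.isProbabilityMeasure
  obtain ⟨R, hR⟩ := hθ.exists_ae_norm_le
  have hcont : ContinuousAt (Function.uncurry (logKernel g)) (x, y) := by
    have h1 : ContinuousAt (fun q : EuclideanSpace ℝ (Fin d) × EuclideanSpace ℝ (Fin d) =>
        logSing (q.1 - q.2)) (x, y) :=
      ContinuousAt.comp (g := logSing) (continuousAt_logSing (sub_ne_zero.2 hxy)) (by fun_prop)
    refine (h1.add hgcont.continuousAt).congr (Eventually.of_forall fun q => ?_)
    exact (logKernel_eq q.1 q.2).symm
  rw [Metric.tendsto_nhds]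
  intro η hη
  obtain ⟨δ, hδ, hball⟩ := Metric.continuousAt_iff.1 hcont (η / 2) (by positivity)
  have hsmall : ∀ᶠ ε : ℝ in 𝓝[Set.Ioc (0 : ℝ) 1] 0, 0 < ε ∧ ε * R < δ := by
    have h1 : ∀ᶠ ε : ℝ in 𝓝 0, ε * R < δ := by
      have : Tendsto (fun ε : ℝ => ε * R) (𝓝 0) (𝓝 (0 * R)) := tendsto_id.mul_const R
      rw [zero_mul] at this
      exact this.eventually_lt_const hδ
    filter_upwards [self_mem_nhdsWithin, nhdsWithin_le_nhds h1] with ε h2 h3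
    exact ⟨h2.1, h3⟩
  filter_upwards [hsmall.prod_mk hsmall] with p ⟨⟨hp1, hp1'⟩, hp2, hp2'⟩
  rw [mollifiedCov_logKernel_eq hg hθ hd hp1 hp2, dist_eq_norm]
  have hconst : logKernel g x y = ∫ _, logKernel g x y
      ∂((mollifierMeasure θ).prod (mollifierMeasure θ)) := by simp
  rw [hconst, ← integral_sub (integrable_logKernel_mollified hg hθ hd p.1 hp2 x y)
    (integrable_const _)]
  refine lt_of_le_of_lt (norm_integral_le_of_norm_le_const (C := η / 2) ?_)
    (by simp only [probReal_univ]; linarith)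
  filter_upwards [Measure.quasiMeasurePreserving_fst.ae hR,
    Measure.quasiMeasurePreserving_snd.ae hR] with q hq1 hq2
  have hclose : dist (x - p.1 • q.1, y - p.2 • q.2) (x, y) < δ := by
    rw [Prod.dist_eq, max_lt_iff]
    simp only [dist_eq_norm, norm_neg, sub_sub_cancel_left, norm_smul, norm_eq_abs, abs_of_pos hp1, abs_of_pos hp2]
    exact ⟨(mul_le_mul_of_nonneg_left hq1 hp1.le).trans_lt hp1',
      (mul_le_mul_of_nonneg_left hq2 hp2.le).trans_lt hp2'⟩
  exact (hball hclose).le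

end MollifiedCovariance

section CrossMoments

open Real Module

variable {Ω : Type*} {X : ℝ → EuclideanSpace ℝ (Fin d) → Ω → ℝ}
  {Km : ℝ → ℝ → EuclideanSpace ℝ (Fin d) → EuclideanSpace ℝ (Fin d) → ℝ}

/-- The normalized exponential `exp(γ X(ε,x) - (γ²/2) Km ε ε x x)`. -/
def wickExp (γ : ℝ) (X : ℝ → EuclideanSpace ℝ (Fin d) → Ω → ℝ)
    (Km : ℝ → ℝ → EuclideanSpace ℝ (Fin d) → EuclideanSpace ℝ (Fin d) → ℝ) (ε : ℝ)
    (x : EuclideanSpace ℝ (Fin d)) (ω : Ω) : ℝ :=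
  exp (γ * X ε x ω - γ ^ 2 / 2 * Km ε ε x x)

lemma wickExp_pos (γ ε : ℝ) (x : EuclideanSpace ℝ (Fin d)) (ω : Ω) :
    0 < wickExp γ X Km ε x ω := exp_pos _

variable [MeasurableSpace Ω] {P : Measure Ω}

lemma IsGaussianFamily.measurable_wickExp (hX : IsGaussianFamily P X Km) (γ ε : ℝ)
    (hKm : Measurable fun x => Km ε ε x x) :
    Measurable fun p : EuclideanSpace ℝ (Fin d) × Ω => wickExp γ X Km ε p.1 p.2 := by
  have h : Measurable fun p : EuclideanSpace ℝ (Fin d) × Ω => X ε p.1 p.2 :=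
    hX.1.comp (f := fun p : EuclideanSpace ℝ (Fin d) × Ω => (ε, p.1, p.2)) (by fun_prop)
  exact ((h.const_mul γ).sub ((hKm.comp measurable_fst).const_mul _)).exp

lemma integrable_exp_mul_of_map_eq_gaussianReal {Y : Ω → ℝ} (hY : AEMeasurable Y P) {m : ℝ}
    {v : ℝ≥0} (h : P.map Y = gaussianReal m v) (t : ℝ) :
    Integrable (fun ω => exp (t * Y ω)) P := by
  have := integrable_exp_mul_gaussianReal (μ := m) (v := v) t
  rw [← h] at this
  exact this.comp_aemeasurable hY

lemma IsGaussianFamily.wickExp_mean (hX : IsGaussianFamily P X Km) (γ : ℝ) {ε : ℝ}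
    (hε : ε ∈ Set.Ioc (0 : ℝ) 1) (x : EuclideanSpace ℝ (Fin d)) :
    Integrable (wickExp γ X Km ε x) P ∧ ∫ ω, wickExp γ X Km ε x ω ∂P = 1 := by
  have hm : Measurable (X ε x) :=
    hX.1.comp (f := fun ω : Ω => (ε, x, ω)) (by fun_prop)
  obtain ⟨v, hv, hmap⟩ := hX.2 1 (fun _ => ε) (fun _ => x) (fun _ => hε) (fun _ => 1)
  simp only [Fin.sum_univ_one, one_mul] at hv hmap
  have hsplit : ∀ ω, wickExp γ X Km ε x ω =
      exp (γ * X ε x ω) * exp (-(γ ^ 2 / 2 * Km ε ε x x)) := fun ω => by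
    rw [← exp_add, wickExp, sub_eq_add_neg]
  have hint : Integrable (fun ω => exp (γ * X ε x ω)) P :=
    integrable_exp_mul_of_map_eq_gaussianReal hm.aemeasurable hmap γ
  have hmgf : ∫ ω, exp (γ * X ε x ω) ∂P = exp (0 * γ + v * γ ^ 2 / 2) :=
    mgf_gaussianReal hmap γ
  constructor
  · exact (hint.mul_const (exp (-(γ ^ 2 / 2 * Km ε ε x x)))).congr
      (Eventually.of_forall fun ω => (hsplit ω).symm)
  · simp only [hsplit]
    rw [integral_mul_const, hmgf, ← exp_add, hv, exp_eq_one_iff]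
    ring

lemma IsGaussianFamily.wickExp_mul (hX : IsGaussianFamily P X Km) (γ : ℝ) {ε ε' : ℝ}
    (hε : ε ∈ Set.Ioc (0 : ℝ) 1) (hε' : ε' ∈ Set.Ioc (0 : ℝ) 1)
    (x y : EuclideanSpace ℝ (Fin d)) :
    Integrable (fun ω => wickExp γ X Km ε x ω * wickExp γ X Km ε' y ω) P ∧
      ∫ ω, wickExp γ X Km ε x ω * wickExp γ X Km ε' y ω ∂P =
        exp (γ ^ 2 / 2 * (Km ε ε' x y + Km ε' ε y x)) := by
  have hm : Measurable (X ε x) :=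
    hX.1.comp (f := fun ω : Ω => (ε, x, ω)) (by fun_prop)
  have hm' : Measurable (X ε' y) :=
    hX.1.comp (f := fun ω : Ω => (ε', y, ω)) (by fun_prop)
  obtain ⟨v, hv, hmap⟩ := hX.2 2 ![ε, ε'] ![x, y]
    (fun i => by fin_cases i <;> simpa) (fun _ => 1)
  simp only [Fin.sum_univ_two, one_mul, Matrix.cons_val_zero, Matrix.cons_val_one] at hv hmap
  have hsplit : ∀ ω, wickExp γ X Km ε x ω * wickExp γ X Km ε' y ω =
      exp (γ * (X ε x ω + X ε' y ω)) *
        exp (-(γ ^ 2 / 2 * (Km ε ε x x + Km ε' ε' y y))) := fun ω => by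
    rw [← exp_add, wickExp, wickExp, ← exp_add]
    congr 1
    ring
  have hint : Integrable (fun ω => exp (γ * (X ε x ω + X ε' y ω))) P :=
    integrable_exp_mul_of_map_eq_gaussianReal (hm.add hm').aemeasurable hmap γ
  have hmgf : ∫ ω, exp (γ * (X ε x ω + X ε' y ω)) ∂P = exp (0 * γ + v * γ ^ 2 / 2) :=
    mgf_gaussianReal hmap γ
  constructor
  · exact (hint.mul_const (exp (-(γ ^ 2 / 2 * (Km ε ε x x + Km ε' ε' y y))))).congr
      (Eventually.of_forall fun ω => (hsplit ω).symm)
  · simp only [hsplit]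
    rw [integral_mul_const, hmgf, ← exp_add, hv]
    congr 1
    ring

variable {f : EuclideanSpace ℝ (Fin d) → ℝ} {A : Set (EuclideanSpace ℝ (Fin d))}

lemma IsGaussianFamily.approxGMC_mean [SFinite P] (hX : IsGaussianFamily P X Km) (γ : ℝ) {ε : ℝ}
    (hε : ε ∈ Set.Ioc (0 : ℝ) 1) (hKm : Measurable fun x => Km ε ε x x)
    (hf0 : ∀ x, 0 ≤ f x) (hf : IntegrableOn f A) (hfmeas : Measurable f) :
    Integrable (fun ω => approxGMC γ X Km f ε ω A) P ∧
      ∫ ω, approxGMC γ X Km f ε ω A ∂P = ∫ x in A, f x := by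
  have hmeas : Measurable fun p : Ω × EuclideanSpace ℝ (Fin d) =>
      wickExp γ X Km ε p.2 p.1 * f p.2 :=
    ((hX.measurable_wickExp γ ε hKm).comp measurable_swap).mul (hfmeas.comp measurable_snd)
  have hmean : ∀ x, ∫ ω, wickExp γ X Km ε x ω * f x ∂P = f x := fun x => by
    rw [integral_mul_const, (hX.wickExp_mean γ hε x).2, one_mul]
  have hint : Integrable (fun p : Ω × EuclideanSpace ℝ (Fin d) =>
      wickExp γ X Km ε p.2 p.1 * f p.2) (P.prod (volume.restrict A)) := by
    rw [integrable_prod_iff' hmeas.aestronglyMeasurable]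
    refine ⟨Eventually.of_forall fun x => (hX.wickExp_mean γ hε x).1.mul_const (f x), ?_⟩
    simp only [norm_of_nonneg (mul_nonneg (wickExp_pos γ ε _ _).le (hf0 _)), hmean]
    exact hf
  refine ⟨hint.integral_prod_left, ?_⟩
  change ∫ ω, (∫ x in A, wickExp γ X Km ε x ω * f x) ∂P = _
  rw [integral_integral_swap hint]
  simp only [hmean]

/-- The density of the second moment `E[M_ε(A) M_ε'(A)]` on `A × A`. -/
def crossDensity (γ : ℝ)
    (Km : ℝ → ℝ → EuclideanSpace ℝ (Fin d) → EuclideanSpace ℝ (Fin d) → ℝ)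
    (f : EuclideanSpace ℝ (Fin d) → ℝ) (ε ε' : ℝ)
    (p : EuclideanSpace ℝ (Fin d) × EuclideanSpace ℝ (Fin d)) : ℝ :=
  exp (γ ^ 2 / 2 * (Km ε ε' p.1 p.2 + Km ε' ε p.2 p.1)) * (f p.1 * f p.2)

lemma IsGaussianFamily.approxGMC_mul [SFinite P] (hX : IsGaussianFamily P X Km) (γ : ℝ)
    {ε ε' : ℝ} (hε : ε ∈ Set.Ioc (0 : ℝ) 1) (hε' : ε' ∈ Set.Ioc (0 : ℝ) 1)
    (hKm : Measurable fun x => Km ε ε x x) (hKm' : Measurable fun x => Km ε' ε' x x)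
    (hf0 : ∀ x, 0 ≤ f x) (hfmeas : Measurable f)
    (hcross : Integrable (crossDensity γ Km f ε ε')
      ((volume.restrict A).prod (volume.restrict A))) :
    Integrable (fun ω => approxGMC γ X Km f ε ω A * approxGMC γ X Km f ε' ω A) P ∧
      ∫ ω, approxGMC γ X Km f ε ω A * approxGMC γ X Km f ε' ω A ∂P =
        ∫ p, crossDensity γ Km f ε ε' p ∂((volume.restrict A).prod (volume.restrict A)) := by
  let F : Ω → EuclideanSpace ℝ (Fin d) × EuclideanSpace ℝ (Fin d) → ℝ := fun ω p =>
    wickExp γ X Km ε p.1 ω * f p.1 * (wickExp γ X Km ε' p.2 ω * f p.2)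
  have hF : ∀ ω p, F ω p =
      wickExp γ X Km ε p.1 ω * wickExp γ X Km ε' p.2 ω * (f p.1 * f p.2) :=
    fun ω p => by simp only [F]; ring
  have hF0 : ∀ ω p, 0 ≤ F ω p := fun ω p =>
    mul_nonneg (mul_nonneg (wickExp_pos γ ε _ _).le (hf0 _))
      (mul_nonneg (wickExp_pos γ ε' _ _).le (hf0 _))
  have hmeas : Measurable (Function.uncurry F) := by
    refine Measurable.mul (Measurable.mul ?_ ?_) (Measurable.mul ?_ ?_)
    · exact (hX.measurable_wickExp γ ε hKm).comp
        (f := fun q : Ω × EuclideanSpace ℝ (Fin d) × EuclideanSpace ℝ (Fin d) => (q.2.1, q.1))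
        (by fun_prop)
    · exact hfmeas.comp (by fun_prop)
    · exact (hX.measurable_wickExp γ ε' hKm').comp
        (f := fun q : Ω × EuclideanSpace ℝ (Fin d) × EuclideanSpace ℝ (Fin d) => (q.2.2, q.1))
        (by fun_prop)
    · exact hfmeas.comp (by fun_prop)
  have hmean : ∀ p, ∫ ω, F ω p ∂P = crossDensity γ Km f ε ε' p := fun p => by
    simp only [hF]
    rw [integral_mul_const, (hX.wickExp_mul γ hε hε' p.1 p.2).2, crossDensity]
  have hint : Integrable (Function.uncurry F)
      (P.prod ((volume.restrict A).prod (volume.restrict A))) := by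
    rw [integrable_prod_iff' hmeas.aestronglyMeasurable]
    refine ⟨Eventually.of_forall fun p => ?_, ?_⟩
    · exact ((hX.wickExp_mul γ hε hε' p.1 p.2).1.mul_const (f p.1 * f p.2)).congr
        (Eventually.of_forall fun ω => (hF ω p).symm)
    · simp only [Function.uncurry_apply_pair, norm_of_nonneg (hF0 _ _), hmean]
      exact hcross
  have hprod : ∀ ω, approxGMC γ X Km f ε ω A * approxGMC γ X Km f ε' ω A =
      ∫ p, F ω p ∂((volume.restrict A).prod (volume.restrict A)) := fun ω =>
    (integral_prod_mul (fun x => wickExp γ X Km ε x ω * f x)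
      (fun y => wickExp γ X Km ε' y ω * f y)).symm
  simp only [hprod]
  refine ⟨hint.integral_prod_left, ?_⟩
  rw [integral_integral_swap hint]
  simp only [hmean]

end CrossMoments

section SecondMoments

open Real Module

lemma MeasureTheory.Integrable.comp_sub_prod {E : Type*} [NormedAddCommGroup E]
    [MeasurableSpace E] [BorelSpace E] [SecondCountableTopology E] {ν : Measure E} [SFinite ν]
    [ν.IsAddLeftInvariant] [ν.IsNegInvariant] {e : E → ℝ} (he : Integrable e ν)
    (hem : Measurable e) {A : Set E} (hA : ν A ≠ ⊤) :
    Integrable (fun p : E × E => e (p.1 - p.2)) ((ν.restrict A).prod (ν.restrict A)) := by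
  have : IsFiniteMeasure (ν.restrict A) := ⟨by simpa using hA.lt_top⟩
  have hm : Measurable fun p : E × E => e (p.1 - p.2) := hem.comp (by fun_prop)
  have hx : ∀ x, Integrable (fun y => e (x - y)) ν := fun x => he.comp_sub_left x
  rw [integrable_prod_iff hm.aestronglyMeasurable]
  refine ⟨Eventually.of_forall fun x => (hx x).restrict, ?_⟩
  refine (integrable_const (∫ y, ‖e y‖ ∂ν)).mono'
    hm.norm.stronglyMeasurable.integral_prod_right'.aestronglyMeasurable
    (Eventually.of_forall fun x => ?_)
  rw [norm_of_nonneg (integral_nonneg fun _ => norm_nonneg _)]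
  refine (setIntegral_le_integral (hx x).norm (Eventually.of_forall fun _ => norm_nonneg _)).trans
    (le_of_eq ?_)
  exact integral_sub_left_eq_self (fun y => ‖e y‖) ν x

lemma ae_fst_ne_snd_prod {E : Type*} [MeasurableSpace E] [MeasurableEq E] {μ ν : Measure E}
    [SFinite ν] [NullSingletonClass ν] : ∀ᵐ p : E × E ∂(μ.prod ν), p.1 ≠ p.2 := by
  have h : MeasurableSet {p : E × E | p.1 = p.2} := measurableSet_diagonal
  rw [ae_iff]
  simp only [not_not]
  rw [Measure.measure_prod_null h]
  refine Eventually.of_forall fun x => ?_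
  have : Prod.mk x ⁻¹' {p : E × E | p.1 = p.2} = {x} := by
    ext y
    simp [eq_comm]
  simp [this]

variable {g : EuclideanSpace ℝ (Fin d) → EuclideanSpace ℝ (Fin d) → ℝ}
  {θ f : EuclideanSpace ℝ (Fin d) → ℝ} {A : Set (EuclideanSpace ℝ (Fin d))}

lemma measurable_crossDensity (hg : IsBoundedMeasurable g) (hθ : IsMollifier θ) (γ : ℝ)
    (hfmeas : Measurable f) {ε ε' : ℝ} (hε : 0 < ε) (hε' : 0 < ε') :
    Measurable (crossDensity γ (mollifiedCov (logKernel g) θ θ) f ε ε') :=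
  (((measurable_mollifiedCov hg.1 hθ hε hε').add
    ((measurable_mollifiedCov hg.1 hθ hε' hε).comp measurable_swap)).const_mul _).exp.mul
    ((hfmeas.comp measurable_fst).mul (hfmeas.comp measurable_snd))

/-- In the `L²` regime the densities of the second moments have a common integrable bound. -/
lemma exists_crossDensity_bound (hd : 1 ≤ d) (hg : IsBoundedMeasurable g) (hθ : IsMollifier θ)
    {γ : ℝ} (hγ : γ ^ 2 < d) (hf0 : ∀ x, 0 ≤ f x) (hfbdd : ∃ C, ∀ x, f x ≤ C)
    (hA : volume A ≠ ⊤) :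
    ∃ D : EuclideanSpace ℝ (Fin d) × EuclideanSpace ℝ (Fin d) → ℝ,
      Integrable D ((volume.restrict A).prod (volume.restrict A)) ∧
      ∀ ε ε' : ℝ, 0 < ε → 0 < ε' → ∀ p, p.1 ≠ p.2 →
        ‖crossDensity γ (mollifiedCov (logKernel g) θ θ) f ε ε' p‖ ≤ D p := by
  obtain ⟨C, hC⟩ := exists_mollifiedCov_le hg hθ hd
  obtain ⟨Cf, hCf⟩ := hfbdd
  have hfin : IsFiniteMeasure (volume.restrict A) := ⟨by simpa using hA.lt_top⟩
  refine ⟨fun p => exp (γ ^ 2 * logSing (p.1 - p.2)) * (exp (γ ^ 2 * C) * (Cf * Cf)), ?_, ?_⟩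
  · refine Integrable.mul_const ?_ _
    have h := (integrable_exp_mul_logSing_sub_one
      (E := EuclideanSpace ℝ (Fin d)) (ν := volume) (by simpa using hd) (sq_nonneg γ)
      (by simpa using hγ)).comp_sub_prod
      (((measurable_logSing.const_mul _).exp).sub_const 1) hA
    simpa only [Pi.add_def, sub_add_cancel] using h.add (integrable_const (1 : ℝ))
  · intro ε ε' hε hε' p hp
    dsimp only
    have h1 := hC ε ε' hε hε' p.1 p.2 hp
    have h2 := hC ε' ε hε' hε p.2 p.1 hp.symm
    rw [logSing_sub_comm] at h2
    have hff : f p.1 * f p.2 ≤ Cf * Cf :=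
      mul_le_mul (hCf _) (hCf _) (hf0 _) ((hf0 p.1).trans (hCf _))
    rw [crossDensity, norm_of_nonneg (mul_nonneg (exp_pos _).le (mul_nonneg (hf0 _) (hf0 _))),
      ← mul_assoc (exp (γ ^ 2 * logSing _)), ← exp_add]
    refine mul_le_mul (exp_le_exp.2 ?_) hff (mul_nonneg (hf0 _) (hf0 _)) (exp_pos _).le
    nlinarith [mul_le_mul_of_nonneg_left (add_le_add h1 h2) (by positivity : 0 ≤ γ ^ 2 / 2)]

lemma tendsto_integral_crossDensity (hd : 1 ≤ d) (hg : IsBoundedMeasurable g)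
    (hgcont : Continuous (Function.uncurry g)) (hθ : IsMollifier θ)
    {γ : ℝ} (hγ : γ ^ 2 < d) (hf0 : ∀ x, 0 ≤ f x) (hfmeas : Measurable f)
    (hfbdd : ∃ C, ∀ x, f x ≤ C) (hA : volume A ≠ ⊤) :
    Tendsto (fun q : ℝ × ℝ => ∫ p, crossDensity γ (mollifiedCov (logKernel g) θ θ) f q.1 q.2 p
        ∂((volume.restrict A).prod (volume.restrict A)))
      ((𝓝[Set.Ioc (0 : ℝ) 1] 0) ×ˢ (𝓝[Set.Ioc (0 : ℝ) 1] 0))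
      (𝓝 (∫ p, crossDensity γ (fun _ _ => logKernel g) f 0 0 p
        ∂((volume.restrict A).prod (volume.restrict A)))) := by
  have : Nonempty (Fin d) := ⟨⟨0, hd⟩⟩
  obtain ⟨D, hD, hle⟩ := exists_crossDensity_bound hd hg hθ hγ hf0 hfbdd hA
  have hpos : ∀ᶠ ε : ℝ in 𝓝[Set.Ioc (0 : ℝ) 1] 0, 0 < ε := by
    filter_upwards [self_mem_nhdsWithin] with ε hε using hε.1
  have hne := ae_fst_ne_snd_prod (μ := (volume : Measure (EuclideanSpace ℝ (Fin d))).restrict A)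
    (ν := volume.restrict A)
  refine tendsto_integral_filter_of_dominated_convergence D ?_ ?_ hD ?_
  · filter_upwards [hpos.prod_mk hpos] with q hq
    exact (measurable_crossDensity hg hθ γ hfmeas hq.1 hq.2).aestronglyMeasurable
  · filter_upwards [hpos.prod_mk hpos] with q hq
    filter_upwards [hne] with p hp
    exact hle _ _ hq.1 hq.2 p hp
  · filter_upwards [hne] with p hp
    have h1 := tendsto_mollifiedCov hg hgcont hθ hd hp
    have h2 := (tendsto_mollifiedCov hg hgcont hθ hd hp.symm).comp (tendsto_snd.prodMk tendsto_fst)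
    exact ((continuous_exp.tendsto _).comp ((h1.add h2).const_mul _)).mul_const _

end SecondMoments

section SquareIntegrable

variable {Ω ι : Type*} [MeasurableSpace Ω] {P : Measure Ω}

lemma MeasureTheory.MemLp.dist_toLp_sq {Y Z : Ω → ℝ} (hY : MemLp Y 2 P) (hZ : MemLp Z 2 P) :
    dist (hY.toLp Y) (hZ.toLp Z) ^ 2 = ∫ ω, (Y ω - Z ω) ^ 2 ∂P := by
  rw [dist_eq_norm, ← MemLp.toLp_sub, ← real_inner_self_eq_norm_sq, L2.inner_def]
  refine integral_congr_ae ?_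
  filter_upwards [(hY.sub hZ).coeFn_toLp] with ω hω
  simp [hω, sq]

/-- A family of square integrable variables whose cross moments converge is Cauchy in `L²`. -/
lemma tendsto_integral_sub_sq_of_tendsto_integral_mul {l : Filter ι} {M : ι → Ω → ℝ}
    (hM : ∀ᶠ i in l, MemLp (M i) 2 P) {L : ℝ}
    (hL : Tendsto (fun p : ι × ι => ∫ ω, M p.1 ω * M p.2 ω ∂P) (l ×ˢ l) (𝓝 L)) :
    Tendsto (fun p : ι × ι => ∫ ω, (M p.1 ω - M p.2 ω) ^ 2 ∂P) (l ×ˢ l) (𝓝 0) := by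
  have hdiag : Tendsto (fun i => ∫ ω, M i ω * M i ω ∂P) l (𝓝 L) :=
    hL.comp (tendsto_id.prodMk tendsto_id)
  have h := ((hdiag.comp tendsto_fst).add (hdiag.comp tendsto_snd)).sub (hL.const_mul 2)
  rw [show L + L - 2 * L = 0 by ring] at h
  refine h.congr' ?_
  filter_upwards [hM.prod_mk hM] with p ⟨h1, h2⟩
  have e1 : Integrable (fun ω => M p.1 ω * M p.1 ω) P := h1.integrable_mul h1
  have e2 : Integrable (fun ω => M p.2 ω * M p.2 ω) P := h2.integrable_mul h2
  have e3 : Integrable (fun ω => 2 * (M p.1 ω * M p.2 ω)) P :=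
    (h1.integrable_mul h2).const_mul 2
  simp only [Function.comp_apply]
  have e12 : Integrable (fun ω => M p.1 ω * M p.1 ω + M p.2 ω * M p.2 ω) P := e1.add e2
  rw [← integral_const_mul, ← integral_add e1 e2, ← integral_sub e12 e3]
  refine integral_congr_ae (Eventually.of_forall fun ω => ?_)
  ring

/-- Completeness of `L²`, for families along a filter. -/
lemma exists_memLp_tendsto_integral_sub_sq {l : Filter ι} [l.NeBot] {M : ι → Ω → ℝ}
    (hM : ∀ᶠ i in l, MemLp (M i) 2 P)
    (hcauchy : Tendsto (fun p : ι × ι => ∫ ω, (M p.1 ω - M p.2 ω) ^ 2 ∂P) (l ×ˢ l) (𝓝 0)) :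
    ∃ Z : Ω → ℝ, MemLp Z 2 P ∧ Tendsto (fun i => ∫ ω, (M i ω - Z ω) ^ 2 ∂P) l (𝓝 0) := by
  classical
  let T : ι → Lp ℝ 2 P := fun i => if h : MemLp (M i) 2 P then h.toLp (M i) else 0
  have hT : ∀ {i} (h : MemLp (M i) 2 P), T i = h.toLp (M i) := fun h => dif_pos h
  have hC : Cauchy (l.map T) := by
    rw [cauchy_map_iff', tendsto_uniformity_iff_dist_tendsto_zero]
    have h := hcauchy.sqrt
    rw [Real.sqrt_zero] at h
    refine h.congr' ?_
    filter_upwards [hM.prod_mk hM] with p ⟨h1, h2⟩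
    rw [hT h1, hT h2, ← h1.dist_toLp_sq h2, Real.sqrt_sq dist_nonneg]
  obtain ⟨z, hz⟩ := cauchy_map_iff_exists_tendsto.1 hC
  refine ⟨z, Lp.memLp z, ?_⟩
  have h := (tendsto_iff_dist_tendsto_zero.1 hz).pow 2
  rw [zero_pow two_ne_zero] at h
  refine h.congr' ?_
  filter_upwards [hM] with i hi
  rw [hT hi, ← hi.dist_toLp_sq (Lp.memLp z), Lp.toLp_coeFn]

lemma tendsto_integral_of_tendsto_integral_sub_sq [IsProbabilityMeasure P] {l : Filter ι}
    {M : ι → Ω → ℝ} {Z : Ω → ℝ} (hM : ∀ᶠ i in l, MemLp (M i) 2 P) (hZ : MemLp Z 2 P)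
    (h : Tendsto (fun i => ∫ ω, (M i ω - Z ω) ^ 2 ∂P) l (𝓝 0)) :
    Tendsto (fun i => ∫ ω, M i ω ∂P) l (𝓝 (∫ ω, Z ω ∂P)) := by
  rw [tendsto_iff_dist_tendsto_zero]
  have h' := h.sqrt
  rw [Real.sqrt_zero] at h'
  refine squeeze_zero' (Eventually.of_forall fun _ => dist_nonneg) ?_ h'
  filter_upwards [hM] with i hi
  have hvar := variance_nonneg (M i - Z) P
  rw [variance_eq_sub (hi.sub hZ)] at hvar
  rw [Real.dist_eq, ← integral_sub (hi.integrable one_le_two) (hZ.integrable one_le_two)]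
  refine Real.abs_le_sqrt ?_
  simpa using hvar

end SquareIntegrable

/-- **Cauchy in `L²`.** Assume `g` continuous. For every `γ ∈ (0, √d)`, bounded measurable
`f ≥ 0` and compact `A`, the family `(M_ε(A))` is Cauchy in `L²(P)` as `ε → 0`:
`E[(M_ε(A) - M_{ε'}(A))²] → 0` as `ε, ε' → 0`. Consequently `M_ε(A)` converges in `L²(P)` to a
random variable `Z(A)` with `E[Z(A)] = ∫_A f`. -/
theorem gmc_L2_cauchy (hd : 1 ≤ d)
    (g : EuclideanSpace ℝ (Fin d) → EuclideanSpace ℝ (Fin d) → ℝ) (hg : IsBoundedMeasurable g)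
    (hgcont : Continuous (Function.uncurry g))
    (θ : EuclideanSpace ℝ (Fin d) → ℝ) (hθ : IsMollifier θ)
    {Ω : Type*} [MeasurableSpace Ω] (P : Measure Ω) [IsProbabilityMeasure P]
    (X : ℝ → EuclideanSpace ℝ (Fin d) → Ω → ℝ)
    (hX : IsGaussianFamily P X (mollifiedCov (logKernel g) θ θ))
    (γ : ℝ) (hγ0 : 0 < γ) (hγd : γ < Real.sqrt d)
    (f : EuclideanSpace ℝ (Fin d) → ℝ) (hf0 : ∀ x, 0 ≤ f x) (hfmeas : Measurable f)
    (hfbdd : ∃ C, ∀ x, f x ≤ C)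
    (A : Set (EuclideanSpace ℝ (Fin d))) (hA : IsCompact A) (hAmeas : MeasurableSet A) :
    Tendsto
      (fun p : ℝ × ℝ => ∫ ω,
        (approxGMC γ X (mollifiedCov (logKernel g) θ θ) f p.1 ω A -
          approxGMC γ X (mollifiedCov (logKernel g) θ θ) f p.2 ω A) ^ 2 ∂P)
      ((𝓝[Set.Ioc (0 : ℝ) 1] 0) ×ˢ (𝓝[Set.Ioc (0 : ℝ) 1] 0)) (𝓝 0) ∧
    ∃ Z : Ω → ℝ,
      Tendsto
        (fun ε => ∫ ω,
          (approxGMC γ X (mollifiedCov (logKernel g) θ θ) f ε ω A - Z ω) ^ 2 ∂P)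
        (𝓝[Set.Ioc (0 : ℝ) 1] 0) (𝓝 0) ∧
      (∫ ω, Z ω ∂P) = ∫ x in A, f x := by
  have hγ : γ ^ 2 < d := by
    have h := Real.sq_sqrt (Nat.cast_nonneg (α := ℝ) d)
    nlinarith
  have hvol : volume A ≠ ⊤ := hA.measure_lt_top.ne
  have hKm : ∀ {ε : ℝ}, 0 < ε → Measurable fun x => mollifiedCov (logKernel g) θ θ ε ε x x :=
    fun hε => (measurable_mollifiedCov hg.1 hθ hε hε).comp
      (f := fun x : EuclideanSpace ℝ (Fin d) => (x, x)) (by fun_prop)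
  have hfint : IntegrableOn f A := by
    obtain ⟨C, hC⟩ := hfbdd
    refine (integrableOn_const hvol (C := C)).mono' hfmeas.aestronglyMeasurable
      (Eventually.of_forall fun x => ?_)
    rw [Real.norm_of_nonneg (hf0 x)]
    exact hC x
  have hcross : ∀ {ε ε' : ℝ}, 0 < ε → 0 < ε' →
      Integrable (crossDensity γ (mollifiedCov (logKernel g) θ θ) f ε ε')
        ((volume.restrict A).prod (volume.restrict A)) := fun {ε ε'} hε hε' => by
    have : Nonempty (Fin d) := ⟨⟨0, hd⟩⟩
    obtain ⟨D, hD, hle⟩ := exists_crossDensity_bound hd hg hθ hγ hf0 hfbdd hvol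
    refine hD.mono' (measurable_crossDensity hg hθ γ hfmeas hε hε').aestronglyMeasurable ?_
    filter_upwards [ae_fst_ne_snd_prod] with p hp using hle ε ε' hε hε' p hp
  have hmean := fun {ε : ℝ} (hε : ε ∈ Set.Ioc (0 : ℝ) 1) =>
    hX.approxGMC_mean γ hε (hKm hε.1) hf0 hfint hfmeas
  have hmul := fun {ε ε' : ℝ} (hε : ε ∈ Set.Ioc (0 : ℝ) 1) (hε' : ε' ∈ Set.Ioc (0 : ℝ) 1) =>
    hX.approxGMC_mul γ hε hε' (hKm hε.1) (hKm hε'.1) hf0 hfmeas (hcross hε.1 hε'.1)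
  have hmem : ∀ᶠ ε in 𝓝[Set.Ioc (0 : ℝ) 1] 0, ε ∈ Set.Ioc (0 : ℝ) 1 := self_mem_nhdsWithin
  have hL2 : ∀ᶠ ε in 𝓝[Set.Ioc (0 : ℝ) 1] 0,
      MemLp (fun ω => approxGMC γ X (mollifiedCov (logKernel g) θ θ) f ε ω A) 2 P := by
    filter_upwards [hmem] with ε hε
    rw [memLp_two_iff_integrable_sq (hmean hε).1.aestronglyMeasurable]
    simpa only [sq] using (hmul hε hε).1
  have hlim : Tendsto (fun q : ℝ × ℝ => ∫ ω,
      approxGMC γ X (mollifiedCov (logKernel g) θ θ) f q.1 ω A *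
        approxGMC γ X (mollifiedCov (logKernel g) θ θ) f q.2 ω A ∂P)
      ((𝓝[Set.Ioc (0 : ℝ) 1] 0) ×ˢ (𝓝[Set.Ioc (0 : ℝ) 1] 0))
      (𝓝 (∫ p, crossDensity γ (fun _ _ => logKernel g) f 0 0 p
        ∂((volume.restrict A).prod (volume.restrict A)))) := by
    refine (tendsto_integral_crossDensity hd hg hgcont hθ hγ hf0 hfmeas hfbdd hvol).congr' ?_
    filter_upwards [hmem.prod_mk hmem] with q hq
    exact (hmul hq.1 hq.2).2.symm
  have hcauchy := tendsto_integral_sub_sq_of_tendsto_integral_mul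
    (M := fun ε ω => approxGMC γ X (mollifiedCov (logKernel g) θ θ) f ε ω A) hL2 hlim
  have : (𝓝[Set.Ioc (0 : ℝ) 1] 0).NeBot := by
    rw [← mem_closure_iff_nhdsWithin_neBot, closure_Ioc zero_ne_one]
    simp
  obtain ⟨Z, hZ, hlimZ⟩ := exists_memLp_tendsto_integral_sub_sq hL2 hcauchy
  refine ⟨hcauchy, Z, hlimZ, ?_⟩
  refine tendsto_nhds_unique (tendsto_integral_of_tendsto_integral_sub_sq hL2 hZ hlimZ)
    (tendsto_const_nhds.congr' ?_)
  filter_upwards [hmem] with ε hε using (hmean hε).2.symm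

end
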